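/- arXiv:1801.00111 — 2 statements merged into one kernel-verified Lean document; each statement's English description precedes it below -/
import Mathlib

section
/- Let T be a tree, let u and x be vertices at odd distance at least 3, let P = u…y z x be the unique u–x path in T (so z is the neighbour of x on P and y the neighbour of z on P closer to u), and let Q be the u–y subpath of P. For a vertex t and an edge e of T, let M(Q, e, ¬t) denote the set of maximum matchings of T that turn Q into a matched path, contain the edge e, and do not cover t. Then for every neighbour w of x with w ≠ z, the map M ↦ (M \ {xw}) ∪ {zx} is a bijection from M(Q, xw, ¬z) onto M(Q, zx, ¬w); in particular |M(Q, xw, ¬z)| = |M(Q, zx, ¬w)|. -/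
/-! Basic definitions: matchings of a simple graph (as finite sets of edges),
maximum matchings, the number `m(T)` of maximum matchings, alternating paths,
the quantity `μ_T(u,v)`, and generalized inverses of real symmetric matrices. -/

variable {V : Type*}

/-- `M` is a matching of `G`: a finite set of edges of `G` that are pairwise
vertex-disjoint. -/
def IsMatching (G : SimpleGraph V) (M : Finset (Sym2 V)) : Prop :=
  (∀ e ∈ M, e ∈ G.edgeSet) ∧
    ∀ e ∈ M, ∀ f ∈ M, e ≠ f → ∀ v : V, ¬(v ∈ e ∧ v ∈ f)

/-- `M` is a maximum matching of `G`: a matching of maximum cardinality. -/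
def IsMaximumMatching (G : SimpleGraph V) (M : Finset (Sym2 V)) : Prop :=
  IsMatching G M ∧ ∀ M' : Finset (Sym2 V), IsMatching G M' → M'.card ≤ M.card

/-- `m(G)`: the number of maximum matchings of `G`. -/
noncomputable def numMaxMatchings (G : SimpleGraph V) : ℕ :=
  {M : Finset (Sym2 V) | IsMaximumMatching G M}.ncard

/-- The matching `M` covers the vertex `v`. -/
def Covers (M : Finset (Sym2 V)) (v : V) : Prop := ∃ e ∈ M, v ∈ e

/-- A vertex `u` is saturated in `G` if every maximum matching of `G` covers it. -/
def Saturated (G : SimpleGraph V) (u : V) : Prop :=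
  ∀ M : Finset (Sym2 V), IsMaximumMatching G M → Covers M u

/-- `p` is a `u_M v` alternating path: a path whose edges belong alternately to `M`
and not to `M`, with both the first and the last edge in `M` (equivalently, the
`i`-th edge lies in `M` iff `i` is even, and the length is odd). -/
def IsAltPath (G : SimpleGraph V) (M : Finset (Sym2 V)) {u v : V} (p : G.Walk u v) : Prop :=
  p.IsPath ∧ Odd p.length ∧
    ∀ (i : ℕ) (h : i < p.edges.length), (p.edges.get ⟨i, h⟩ ∈ M ↔ Even i)

/-- There exists a `u_M v` alternating path in `G`. -/
def HasAltPath (G : SimpleGraph V) (M : Finset (Sym2 V)) (u v : V) : Prop :=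
  ∃ p : G.Walk u v, IsAltPath G M p

/-- `μ_G(u,v)`: the sign `σ(u,v)` (which is `+1` if `dist(u,v) ≡ 1 (mod 4)` and `-1`
if `dist(u,v) ≡ 3 (mod 4)`) times the number of maximum matchings `M` of `G` admitting
a `u_M v` alternating path; it is `0` when no such maximum matching exists. -/
noncomputable def muT (G : SimpleGraph V) (u v : V) : ℤ :=
  (if G.dist u v % 4 = 1 then 1 else -1) *
    ({M : Finset (Sym2 V) | IsMaximumMatching G M ∧ HasAltPath G M u v}.ncard : ℤ)

/-- `B` is the generalized inverse of the real symmetric matrix `A`: the (unique)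
symmetric matrix `B` with `ABA = A`, `BAB = B` and `AB = BA`. -/
def IsGenInverse {n : Type*} [Fintype n] (A B : Matrix n n ℝ) : Prop :=
  B.IsSymm ∧ A * B * A = A ∧ B * A * B = B ∧ A * B = B * A

theorem swap_aux {V : Type*} [DecidableEq V] (G : SimpleGraph V)
    {u y : V} (Q : G.Walk u y) (x a b : V) (hxQ : x ∉ Q.support) (hxa : G.Adj x a)
    (hxb : G.Adj x b) (hab : a ≠ b) (M : Finset (Sym2 V))
    (hM : IsMaximumMatching G M ∧ IsAltPath G M Q ∧ s(x, a) ∈ M ∧ ¬ Covers M b) :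
    (IsMaximumMatching G (insert s(x, b) (M.erase s(x, a))) ∧
      IsAltPath G (insert s(x, b) (M.erase s(x, a))) Q ∧
      s(x, b) ∈ insert s(x, b) (M.erase s(x, a)) ∧
      ¬ Covers (insert s(x, b) (M.erase s(x, a))) a) ∧
    insert s(x, a) ((insert s(x, b) (M.erase s(x, a))).erase s(x, b)) = M := by
  obtain ⟨⟨⟨hE, hD⟩, hmax⟩, ⟨hp, ho, hi⟩, ha, hb⟩ := hM
  have hbM : s(x, b) ∉ M := fun h => hb ⟨_, h, by simp⟩
  have hb' : ∀ f ∈ M, b ∉ f := fun f hf h => hb ⟨f, hf, h⟩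
  have hx' : ∀ f ∈ M, f ≠ s(x, a) → x ∉ f := fun f hf hne h => hD f hf _ ha hne x ⟨h, by simp⟩
  have ha' : ∀ f ∈ M, f ≠ s(x, a) → a ∉ f := fun f hf hne h => hD f hf _ ha hne a ⟨h, by simp⟩
  have hbe : s(x, b) ∉ M.erase s(x, a) := fun h => hbM (Finset.mem_of_mem_erase h)
  have hcard : (insert s(x, b) (M.erase s(x, a))).card = M.card := by
    rw [Finset.card_insert_of_notMem hbe, Finset.card_erase_add_one ha]
  refine ⟨⟨⟨⟨?_, ?_⟩, ?_⟩, ⟨hp, ho, ?_⟩, Finset.mem_insert_self _ _, ?_⟩, ?_⟩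
  · intro e he
    rcases Finset.mem_insert.1 he with rfl | he
    · exact hxb
    · exact hE e (Finset.mem_of_mem_erase he)
  · intro e he f hf hne v
    rw [Finset.mem_insert, Finset.mem_erase] at he hf
    rintro ⟨h1, h2⟩
    rcases he with rfl | ⟨hea, he⟩ <;> rcases hf with rfl | ⟨hfa, hf⟩
    · exact hne rfl
    · rcases Sym2.mem_iff.1 h1 with rfl | rfl
      · exact hx' f hf hfa h2
      · exact hb' f hf h2
    · rcases Sym2.mem_iff.1 h2 with rfl | rfl
      · exact hx' e he hea h1
      · exact hb' e he h1
    · exact hD e he f hf hne v ⟨h1, h2⟩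
  · intro M' hM'
    rw [hcard]
    exact hmax M' hM'
  · intro i h
    rw [← hi i h]
    have hmem : Q.edges.get ⟨i, h⟩ ∈ Q.edges := List.get_mem _ _
    have key : ∀ c, Q.edges.get ⟨i, h⟩ ≠ s(x, c) := by
      intro c hc
      rw [hc] at hmem
      exact hxQ (Q.fst_mem_support_of_mem_edges hmem)
    rw [Finset.mem_insert, Finset.mem_erase]
    have k1 := key a
    have k2 := key b
    tauto
  · rintro ⟨e, he, h⟩
    rw [Finset.mem_insert, Finset.mem_erase] at he
    rcases he with rfl | ⟨hea, he⟩
    · rcases Sym2.mem_iff.1 h with h | h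
      · exact hxa.ne h.symm
      · exact hab h
    · exact ha' e he hea h
  · rw [Finset.erase_insert hbe, Finset.insert_erase ha]

/-- Let `T` be a tree and `u`, `x` vertices at odd distance at least `3`.
Let `P = u…y z x` be the unique `u–x` path (`z` the neighbour of `x` on `P`, `y` the
neighbour of `z` on `P` closer to `u`) and `Q` the `u–y` subpath of `P`. For every neighbour
`w ≠ z` of `x`, the map `M ↦ (M \ {xw}) ∪ {zx}` is a bijection from the set of maximum
matchings turning `Q` into a matched path, containing `xw` and not covering `z`, onto the set
of those turning `Q` into a matched path, containing `zx` and not covering `w`; in particular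
these two sets have the same cardinality. -/
theorem stmt12 {V : Type*} [Fintype V] [DecidableEq V] (G : SimpleGraph V)
    [DecidableRel G.Adj] (hT : G.IsTree)
    (u x y z : V) (hodd : Odd (G.dist u x)) (h3 : 3 ≤ G.dist u x)
    (Q : G.Walk u y) (hyz : G.Adj y z) (hzx : G.Adj z x)
    (hP : ((Q.concat hyz).concat hzx).IsPath)
    (w : V) (hxw : G.Adj x w) (hwz : w ≠ z) :
    Set.BijOn (fun M : Finset (Sym2 V) => insert s(z, x) (M.erase s(x, w)))
        {M : Finset (Sym2 V) | IsMaximumMatching G M ∧ IsAltPath G M Q ∧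
          s(x, w) ∈ M ∧ ¬ Covers M z}
        {M : Finset (Sym2 V) | IsMaximumMatching G M ∧ IsAltPath G M Q ∧
          s(z, x) ∈ M ∧ ¬ Covers M w} ∧
      {M : Finset (Sym2 V) | IsMaximumMatching G M ∧ IsAltPath G M Q ∧
          s(x, w) ∈ M ∧ ¬ Covers M z}.ncard
        = {M : Finset (Sym2 V) | IsMaximumMatching G M ∧ IsAltPath G M Q ∧
          s(z, x) ∈ M ∧ ¬ Covers M w}.ncard := by
  have hxQ : x ∉ Q.support := by
    rw [SimpleGraph.Walk.concat_isPath_iff] at hP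
    intro h
    exact hP.2 (by simp [SimpleGraph.Walk.support_concat, h])
  have hb : Set.BijOn (fun M : Finset (Sym2 V) => insert s(z, x) (M.erase s(x, w)))
        {M : Finset (Sym2 V) | IsMaximumMatching G M ∧ IsAltPath G M Q ∧
          s(x, w) ∈ M ∧ ¬ Covers M z}
        {M : Finset (Sym2 V) | IsMaximumMatching G M ∧ IsAltPath G M Q ∧
          s(z, x) ∈ M ∧ ¬ Covers M w} := by
    rw [Sym2.eq_swap (a := z) (b := x)]
    have A := swap_aux G Q x w z hxQ hxw hzx.symm hwz
    have B := swap_aux G Q x z w hxQ hzx.symm hxw hwz.symm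
    refine Set.BijOn.mk (fun M hM => (A M hM).1) ?_ ?_
    · intro M hM N hN hMN
      have h := congrArg (fun K : Finset (Sym2 V) => insert s(x, w) (K.erase s(x, z))) hMN
      dsimp only at h
      rwa [(A M hM).2, (A N hN).2] at h
    · intro M hM
      exact ⟨_, (B M hM).1, (B M hM).2⟩
  exact ⟨hb, by rw [← hb.image_eq, Set.ncard_image_of_injOn hb.injOn]⟩
end

section
/- Let T be a tree with at least three vertices, let x be a pendant vertex of T that is an end-vertex of a longest path of T, let y be the neighbour of x, and let T − x be the tree obtained by deleting x. If the degree of y in T is at least 3, then y is saturated in T − x, i.e., every maximum matching of T − x covers y. -/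
/-! Basic definitions: matchings of a simple graph (as finite sets of edges),
maximum matchings, the number `m(T)` of maximum matchings, alternating paths,
the quantity `μ_T(u,v)`, and generalized inverses of real symmetric matrices. -/

variable {V : Type*}

/-- Let `T` be a tree with at least three vertices, `x` a pendant vertex of
`T` that is an end-vertex of a longest path of `T`, and `y` the neighbour of `x`. If the
degree of `y` in `T` is at least `3`, then `y` is saturated in `T − x` (here realized as the
graph on `V` obtained by deleting all edges incident to `x`): every maximum matching of
`T − x` covers `y`. -/
theorem stmt16 {V : Type*} [Fintype V] [DecidableEq V] (G : SimpleGraph V)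
    [DecidableRel G.Adj] (hT : G.IsTree) (hV : 3 ≤ Fintype.card V)
    (x y : V) (hx : G.degree x = 1) (hxy : G.Adj x y)
    (a : V) (p : G.Walk a x) (hp : p.IsPath)
    (hlong : ∀ (b c : V) (q : G.Walk b c), q.IsPath → q.length ≤ p.length)
    (hdeg : 3 ≤ G.degree y) :
    Saturated (G.deleteEdges {e : Sym2 V | x ∈ e}) y := by
  have hac := hT.isAcyclic
  have hlen : 1 ≤ p.length := by
    have h1 := hlong x y (SimpleGraph.Walk.cons hxy SimpleGraph.Walk.nil) (by
      simp [hxy.ne])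
    simpa using h1
  have hnil : ¬ p.Nil := by
    intro h
    have := SimpleGraph.Walk.nil_iff_length_eq.1 h
    omega
  have hpen : p.penultimate = y := by
    obtain ⟨z, hz, huz⟩ := SimpleGraph.degree_eq_one_iff_existsUnique_adj.1 hx
    rw [huz y hxy]
    exact huz _ (SimpleGraph.Walk.adj_penultimate hnil).symm
  obtain ⟨q, hq, hql⟩ : ∃ q : G.Walk a y, q.IsPath ∧ q.length + 1 = p.length := by
    have h1 := hp.dropLast
    have h2 := SimpleGraph.Walk.length_dropLast_add_one hnil
    subst hpen
    exact ⟨_, h1, h2⟩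
  obtain ⟨w, hw, hwx, hwq⟩ : ∃ w, G.Adj y w ∧ w ≠ x ∧ w ≠ q.penultimate := by
    by_contra! hcon
    have hsub : G.neighborFinset y ⊆ {x, q.penultimate} := by
      intro w hw
      rw [SimpleGraph.mem_neighborFinset] at hw
      by_cases h : w = x
      · simp [h]
      · simp [hcon w hw h]
    have h1 := Finset.card_le_card hsub
    have h2 : ({x, q.penultimate} : Finset V).card ≤ 2 := Finset.card_le_two
    rw [SimpleGraph.card_neighborFinset_eq_degree] at h1
    omega
  have hwns : w ∉ q.support := fun h => hwq (hac.eq_penultimate_of_adj_end hq hw h)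
  have hleaf : ∀ u, G.Adj w u → u = y := by
    intro u hu
    have hqc := hq.concat hwns hw
    have hmem : u ∈ (q.concat hw).support := by
      by_contra h
      have := hlong _ _ _ (hqc.concat h hu)
      simp only [SimpleGraph.Walk.length_concat] at this
      omega
    have := hac.eq_penultimate_of_adj_end hqc hu hmem
    simpa using this
  intro M hM
  by_contra hc
  have hyM : ∀ e ∈ M, y ∉ e := fun e he hy => hc ⟨e, he, hy⟩
  have hwM : ∀ e ∈ M, w ∉ e := by
    intro e he hwe
    obtain ⟨u, rfl⟩ := Sym2.mem_iff_exists.1 hwe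
    have h1 := hM.1.1 _ he
    rw [SimpleGraph.mem_edgeSet, SimpleGraph.deleteEdges_adj] at h1
    have := hleaf u h1.1
    subst this
    exact hyM _ he (by simp)
  have hnot : s(y, w) ∉ M := fun h => hyM _ h (by simp)
  have hmat : IsMatching (G.deleteEdges {e : Sym2 V | x ∈ e}) (insert s(y, w) M) := by
    have key : ∀ f ∈ M, ∀ v, ¬ (v ∈ s(y, w) ∧ v ∈ f) := by
      rintro f hf v ⟨hv, hvf⟩
      rcases Sym2.mem_iff.1 hv with rfl | rfl
      · exact hyM f hf hvf
      · exact hwM f hf hvf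
    constructor
    · intro e he
      rcases Finset.mem_insert.1 he with rfl | he
      · rw [SimpleGraph.mem_edgeSet, SimpleGraph.deleteEdges_adj]
        refine ⟨hw, ?_⟩
        simp [hxy.ne, hwx.symm]
      · exact hM.1.1 e he
    · intro e he f hf hef v
      rcases Finset.mem_insert.1 he with rfl | he <;>
        rcases Finset.mem_insert.1 hf with rfl | hf
      · exact absurd rfl hef
      · exact key f hf v
      · exact fun h => key e he v h.symm
      · exact hM.1.2 e he f hf hef v
  have := hM.2 _ hmat
  rw [Finset.card_insert_of_notMem hnot] at this
  omega
end
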